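/- (Block determinant identity used in the proof of Lemma 4.5.) Let R be a commutative ring, let m and r be positive integers, and let B be a family of matrices B_{ij} ∈ M_r(R) indexed by i, j ∈ {1, …, m}. Let A ∈ M_{mr}(R) be the block matrix whose (i,j) block is B_{ij}. Suppose that there is exactly one permutation σ of {1, …, m} such that B_{i,σ(i)} ≠ 0 (as a matrix) for all i = 1, …, m. Then det(A) = sign(σ)^r · ∏_{i=1}^m det(B_{i,σ(i)}). -/

import Mathlib

open Matrix

/-- If the only permutation `τ` with `P (τ i) i` for all `i` is the identity, then the off-diagonal
part of `P` has no cycles, i.e. is well-founded. -/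
theorem wellFounded_of_unique_perm {ι : Type*} [Finite ι] {P : ι → ι → Prop}
    (hrefl : ∀ i, P i i) (huniq : ∀ τ : Equiv.Perm ι, (∀ i, P (τ i) i) → τ = 1) :
    WellFounded fun i j => P i j ∧ i ≠ j := by
  classical
  rw [WellFounded.wellFounded_iff_has_min]
  intro S hS
  by_contra! hcon
  choose g hgS hgP hgne using hcon
  let f : ι → ι := fun i => if h : i ∈ S then g i h else i
  have hfS : ∀ i ∈ S, f i ∈ S := fun i hi => by simp only [f, dif_pos hi, hgS]
  have hfP : ∀ i, P (f i) i := fun i => by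
    by_cases hi : i ∈ S
    · simpa only [f, dif_pos hi] using hgP i hi
    · simpa only [f, dif_neg hi] using hrefl i
  have hfne : ∀ i ∈ S, f i ≠ i := fun i hi => by simpa only [f, dif_pos hi] using hgne i hi
  obtain ⟨x, hxS, hxper⟩ : ∃ x ∈ S, x ∈ Function.periodicPts f := by
    obtain ⟨s, hs⟩ := hS
    have hiter : ∀ n, f^[n] s ∈ S := fun n => by
      induction n with
      | zero => exact hs
      | succ n ih => rw [Function.iterate_succ_apply']; exact hfS _ ih
    obtain ⟨a, b, hab, heq⟩ := Finite.exists_ne_map_eq_of_infinite fun n => f^[n] s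
    wlog hlt : a < b generalizing a b
    · exact this b a hab.symm heq.symm (by omega)
    refine ⟨f^[a] s, hiter a, b - a, by omega, ?_⟩
    rw [Function.IsPeriodicPt, Function.IsFixedPt, ← Function.iterate_add_apply,
      Nat.sub_add_cancel hlt.le]
    exact heq.symm
  have hbij : Function.Bijective ((Function.periodicPts f).piecewise f id) := by
    rw [← Finite.injective_iff_bijective, Set.injective_piecewise_iff]
    have hb := Function.bijOn_periodicPts f
    refine ⟨hb.injOn, Function.injective_id.injOn, fun a ha b hb' hab => hb' ?_⟩
    have hmem := hb.mapsTo ha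
    rwa [hab] at hmem
  have hone := huniq (Equiv.ofBijective _ hbij) fun i => by
    by_cases hi : i ∈ Function.periodicPts f
    · simpa [hi] using hfP i
    · simpa [hi] using hrefl i
  apply hfne x hxS
  simpa [hxper] using congrArg (fun e : Equiv.Perm ι => e x) hone

/-- A block matrix whose off-diagonal nonzero blocks form a well-founded relation has determinant
the product of the determinants of its diagonal blocks. -/
theorem det_comp_of_wellFounded {ι κ R : Type*} [CommRing R] [Fintype ι] [DecidableEq ι]
    [Fintype κ] [DecidableEq κ] (C : ι → ι → Matrix κ κ R)
    (hwf : WellFounded fun i j => C i j ≠ 0 ∧ i ≠ j) :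
    (Matrix.of fun p q : ι × κ => C p.1 q.1 p.2 q.2).det = ∏ i, (C i i).det := by
  classical
  have : IsWellFounded ι fun i j => C i j ≠ 0 ∧ i ≠ j := ⟨hwf⟩
  obtain ⟨s, hs, hwo⟩ := IsWellFounded.exists_well_order_ge fun i j => C i j ≠ 0 ∧ i ≠ j
  let _ : LinearOrder ι := linearOrderOfSTO s
  have htri : (Matrix.of fun p q : ι × κ => C p.1 q.1 p.2 q.2).BlockTriangular Prod.fst := by
    intro p q hqp
    by_contra hne
    refine lt_asymm hqp (hs p.1 q.1 ⟨fun h0 => hne ?_, hqp.ne'⟩)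
    simp [h0]
  have hdet := htri.det_fintype
  convert hdet using 2 with i
  let e : κ ≃ {p : ι × κ // p.1 = i} :=
    { toFun := fun k => ⟨(i, k), rfl⟩
      invFun := fun p => p.1.2
      left_inv := fun _ => rfl
      right_inv := by rintro ⟨⟨_, _⟩, rfl⟩; rfl }
  rw [← det_submatrix_equiv_self e]
  rfl

/-- **Block determinant identity used in the proof of Lemma 4.5.**
If `A` is the `mr × mr` block matrix with blocks `B i j ∈ M_r(R)` and there is exactly one
permutation `σ` of `{1,…,m}` with `B i (σ i) ≠ 0` for all `i`, then
`det A = sign(σ)^r · ∏ i, det (B i (σ i))`. -/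
theorem block_det_unique_perm (R : Type) [CommRing R] (m r : ℕ) (hm : 0 < m) (hr : 0 < r)
    (B : Fin m → Fin m → Matrix (Fin r) (Fin r) R)
    (σ : Equiv.Perm (Fin m)) (hσ : ∀ i, B i (σ i) ≠ 0)
    (huniq : ∀ τ : Equiv.Perm (Fin m), (∀ i, B i (τ i) ≠ 0) → τ = σ) :
    (Matrix.of fun p q : Fin m × Fin r => B p.1 q.1 p.2 q.2).det
      = ((Equiv.Perm.sign σ : ℤ) : R) ^ r * ∏ i, (B i (σ i)).det := by
  have hwf : WellFounded fun i j => B i (σ j) ≠ 0 ∧ i ≠ j := by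
    refine wellFounded_of_unique_perm (P := fun i j => B i (σ j) ≠ 0) hσ fun τ hτ => ?_
    have h := huniq (σ * τ⁻¹) fun i => by simpa using hτ (τ⁻¹ i)
    simpa using h
  have hperm := det_permute' (Equiv.prodCongrLeft fun _ : Fin r => σ)
    (Matrix.of fun p q : Fin m × Fin r => B p.1 q.1 p.2 q.2)
  rw [← det_comp_of_wellFounded (fun i j => B i (σ j)) hwf]
  change (Matrix.of fun p q : Fin m × Fin r => B p.1 (σ q.1) p.2 q.2).det = _ at hperm
  have hsq : ((Equiv.Perm.sign σ : ℤ) : R) ^ r * ((Equiv.Perm.sign σ : ℤ) : R) ^ r = 1 := by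
    rw [← mul_pow, ← Int.cast_mul, ← Units.val_mul, Int.units_mul_self]
    simp
  rw [hperm, Equiv.Perm.sign_prodCongrLeft]
  simp [← mul_assoc, hsq]
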